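/- Let θ_{1,0} = z³, θ_{2,0} = z², θ_{3,0} = z¹, and let θ_{1,1} = z¹(z³ + log z¹ − 1) + ½(z²)² + √2 z² e^{z³} + ½ e^{2z³}, θ_{2,1} = z¹z² + √2 z¹ e^{z³} − (1/6)(z²)³, θ_{3,1} = ½(z¹)² + √2 z¹z² e^{z³} + z¹ e^{2z³}. Then on the domain z¹ > 0, for each i ∈ {1,2,3} and all α,β ∈ {1,2,3}: ∂²θ_{i,1}/∂z^α∂z^β = Σ_γ c^γ_{αβ} ∂θ_{i,0}/∂z^γ. -/

import Mathlib

/-- Partial derivative in the first slot. -/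
noncomputable def pd1 (f : ℝ → ℝ → ℝ → ℝ) : ℝ → ℝ → ℝ → ℝ :=
  fun x y z => deriv (fun t => f t y z) x

/-- Partial derivative in the second slot. -/
noncomputable def pd2 (f : ℝ → ℝ → ℝ → ℝ) : ℝ → ℝ → ℝ → ℝ :=
  fun x y z => deriv (fun t => f x t z) y

/-- Partial derivative in the third slot. -/
noncomputable def pd3 (f : ℝ → ℝ → ℝ → ℝ) : ℝ → ℝ → ℝ → ℝ :=
  fun x y z => deriv (fun t => f x y t) z

/-- Partial derivative in the (i+1)-st variable. -/
noncomputable def pd (i : Fin 3) : (ℝ → ℝ → ℝ → ℝ) → (ℝ → ℝ → ℝ → ℝ) :=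
  ![pd1, pd2, pd3] i

/-- The potential of the generalized Frobenius manifold of the (2,1)-type RR2T. -/
noncomputable def Fpot (x y z : ℝ) : ℝ :=
  (1/2) * x^2 * z + (1/2) * x * y^2 + Real.sqrt 2 * x * y * Real.exp z
    + (1/2) * x * Real.exp (2*z) - (1/24) * y^4 + (1/2) * x^2 * Real.log x

/-- The flat metric η, with η_{αβ} = 1 iff α + β = 4 (indices shifted to 0,1,2). -/
noncomputable def eta (a b : Fin 3) : ℝ := if (a : ℕ) + (b : ℕ) = 2 then 1 else 0

/-- Third partial derivatives c_{αβγ} = ∂³F/∂z^α∂z^β∂z^γ of the potential. -/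
noncomputable def cF (a b g : Fin 3) : ℝ → ℝ → ℝ → ℝ := pd a (pd b (pd g Fpot))

/-- Structure constants with one index raised: c^γ_{αβ} = Σ_δ η^{γδ} c_{δαβ}. -/
noncomputable def cup (g a b : Fin 3) (x y z : ℝ) : ℝ :=
  ∑ d : Fin 3, eta g d * cF d a b x y z

/-- θ_{1,0} = z³. -/
noncomputable def θ10 (x y z : ℝ) : ℝ := z
/-- θ_{2,0} = z². -/
noncomputable def θ20 (x y z : ℝ) : ℝ := y
/-- θ_{3,0} = z¹. -/
noncomputable def θ30 (x y z : ℝ) : ℝ := x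

/-- θ_{1,1}. -/
noncomputable def θ11 (x y z : ℝ) : ℝ :=
  x * (z + Real.log x - 1) + (1/2)*y^2 + Real.sqrt 2 * y * Real.exp z + (1/2) * Real.exp (2*z)
/-- θ_{2,1}. -/
noncomputable def θ21 (x y z : ℝ) : ℝ :=
  x*y + Real.sqrt 2 * x * Real.exp z - (1/6)*y^3
/-- θ_{3,1}. -/
noncomputable def θ31 (x y z : ℝ) : ℝ :=
  (1/2)*x^2 + Real.sqrt 2 * x * y * Real.exp z + x * Real.exp (2*z)

/-- The densities `θ_{i,1}` as a family. -/
noncomputable def thetaOne (i : Fin 3) : ℝ → ℝ → ℝ → ℝ := ![θ11, θ21, θ31] i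

/-- Closed forms of the first partial derivatives of `θ_{i,1}`. -/
noncomputable def thetaOneGrad (i j : Fin 3) (x y z : ℝ) : ℝ :=
  ![![z + Real.log x, y + √2 * Real.exp z, x + √2 * y * Real.exp z + Real.exp (2*z)],
    ![y + √2 * Real.exp z, x - (1/2) * y^2, √2 * x * Real.exp z],
    ![x + √2 * y * Real.exp z + Real.exp (2*z), √2 * x * Real.exp z,
      √2 * x * y * Real.exp z + 2 * x * Real.exp (2*z)]] i j

/-- Closed forms of the second partial derivatives of `θ_{i,1}`. -/
noncomputable def thetaOneHess (i j k : Fin 3) (x y z : ℝ) : ℝ :=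
  ![![![x⁻¹, 0, 1], ![0, 1, √2 * Real.exp z],
      ![1, √2 * Real.exp z, √2 * y * Real.exp z + 2 * Real.exp (2*z)]],
    ![![0, 1, √2 * Real.exp z], ![1, -y, 0], ![√2 * Real.exp z, 0, √2 * x * Real.exp z]],
    ![![1, √2 * Real.exp z, √2 * y * Real.exp z + 2 * Real.exp (2*z)],
      ![√2 * Real.exp z, 0, √2 * x * Real.exp z],
      ![√2 * y * Real.exp z + 2 * Real.exp (2*z), √2 * x * Real.exp z,
        √2 * x * y * Real.exp z + 4 * x * Real.exp (2*z)]]] i j k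

theorem pd_congr {f g : ℝ → ℝ → ℝ → ℝ} (h : ∀ x y z, 0 < x → f x y z = g x y z) (i : Fin 3)
    (x y z : ℝ) (hx : 0 < x) : pd i f x y z = pd i g x y z := by
  fin_cases i
  · apply Filter.EventuallyEq.deriv_eq
    filter_upwards [lt_mem_nhds hx] with t ht using h t y z ht
  · exact congrArg (fun u => deriv u y) (funext fun t => h x t z hx)
  · exact congrArg (fun u => deriv u z) (funext fun t => h x y t hx)

theorem hasDerivAt_exp_two_mul (z : ℝ) :
    HasDerivAt (fun t => Real.exp (2 * t)) (2 * Real.exp (2 * z)) z := by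
  simpa [mul_comm] using ((hasDerivAt_id z).const_mul 2).exp

theorem pd_thetaOne (i j : Fin 3) (x y z : ℝ) (hx : 0 < x) :
    pd j (thetaOne i) x y z = thetaOneGrad i j x y z := by
  have hx' := hx.ne'
  fin_cases i <;> fin_cases j <;>
    simp (disch := fun_prop (disch := assumption)) [pd, pd1, pd2, pd3, thetaOne, thetaOneGrad, θ11, θ21, θ31, deriv_fun_add, deriv_fun_sub, deriv_fun_mul, deriv_fun_pow,
      (hasDerivAt_exp_two_mul _).deriv]
  all_goals try (field_simp; try ring)

theorem pd_thetaOneGrad (i j k : Fin 3) (x y z : ℝ) (hx : 0 < x) :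
    pd k (thetaOneGrad i j) x y z = thetaOneHess i j k x y z := by
  have hx' := hx.ne'
  fin_cases i <;> fin_cases j <;> fin_cases k <;>
    simp (disch := fun_prop (disch := assumption)) [pd, pd1, pd2, pd3, thetaOneGrad, thetaOneHess, deriv_fun_add, deriv_fun_sub, deriv_fun_mul, deriv_fun_pow,
      (hasDerivAt_exp_two_mul _).deriv]
  all_goals try (field_simp; try ring)

theorem pd_Fpot (i : Fin 3) (x y z : ℝ) (hx : 0 < x) :
    pd i Fpot x y z = thetaOne i x y z + (![3 / 2, 0, 0] : Fin 3 → ℝ) i * x := by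
  have hx' := hx.ne'
  fin_cases i <;> simp (disch := fun_prop (disch := assumption)) [pd, pd1, pd2, pd3, thetaOne, Fpot, θ11, θ21, θ31, deriv_fun_add, deriv_fun_sub, deriv_fun_mul, deriv_fun_pow,
      (hasDerivAt_exp_two_mul _).deriv]
  all_goals try (field_simp; try ring)

theorem pd_pd_Fpot (i j : Fin 3) (x y z : ℝ) (hx : 0 < x) :
    pd j (pd i Fpot) x y z =
      thetaOneGrad i j x y z + (![![3 / 2, 0, 0], 0, 0] : Fin 3 → Fin 3 → ℝ) i j := by
  rw [pd_congr (pd_Fpot i) j x y z hx]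
  have hx' := hx.ne'
  fin_cases i <;> fin_cases j <;>
    simp (disch := fun_prop (disch := assumption)) [pd, pd1, pd2, pd3, thetaOne, thetaOneGrad, θ11, θ21, θ31, deriv_fun_add, deriv_fun_sub, deriv_fun_mul, deriv_fun_pow,
      (hasDerivAt_exp_two_mul _).deriv]
  all_goals try (field_simp; try ring)

theorem cF_eq_thetaOneHess (d a b : Fin 3) (x y z : ℝ) (hx : 0 < x) :
    cF d a b x y z = thetaOneHess b a d x y z := by
  rw [cF, pd_congr (pd_pd_Fpot b a) d x y z hx, ← pd_thetaOneGrad b a d x y z hx]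
  fin_cases d <;> simp [pd, pd1, pd2, pd3]

/-- the Principal Hierarchy recursion relations
∂²θ_{i,1}/∂z^α∂z^β = Σ_γ c^γ_{αβ} ∂θ_{i,0}/∂z^γ for i = 1,2,3. -/
theorem recursion_theta_level1 (x y z : ℝ) (hx : 0 < x) :
    (∀ α β : Fin 3,
      pd α (pd β θ11) x y z = ∑ γ : Fin 3, cup γ α β x y z * pd γ θ10 x y z)
    ∧ (∀ α β : Fin 3,
      pd α (pd β θ21) x y z = ∑ γ : Fin 3, cup γ α β x y z * pd γ θ20 x y z)
    ∧ (∀ α β : Fin 3,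
      pd α (pd β θ31) x y z = ∑ γ : Fin 3, cup γ α β x y z * pd γ θ30 x y z) := by
  have hθ (i α β : Fin 3) : pd α (pd β (thetaOne i)) x y z = thetaOneHess i β α x y z :=
    (pd_congr (pd_thetaOne i β) α x y z hx).trans (pd_thetaOneGrad i β α x y z hx)
  have hc (d a b : Fin 3) : cF d a b x y z = thetaOneHess b a d x y z :=
    cF_eq_thetaOneHess d a b x y z hx
  refine ⟨fun α β => (hθ 0 α β).trans ?_, fun α β => (hθ 1 α β).trans ?_,
    fun α β => (hθ 2 α β).trans ?_⟩ <;>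
  simp only [cup, hc] <;> fin_cases α <;> fin_cases β <;>
    simp [Fin.sum_univ_three, eta, pd, pd1, pd2, pd3, θ10, θ20, θ30, thetaOneHess]
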